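/- For all natural numbers a, b with 2a ≤ b, if G(0, a, b) = 1 then a = 0, or a = 2, or (a, b) = (1, 2); that is, among positions (0,a,b) with a ≤ b/2, the positions of Sprague–Grundy value 1 lie only on the rows a = 0 and a = 2, except for the single position (0,1,2). -/

import Mathlib

namespace SharingNim

/-- The moves of three-pile Sharing Nim: take `k ≥ 1` tokens from one pile and add them to
another pile, provided the receiving pile has at most as many tokens as the source pile
after the move (i.e. `2 * k` is at most the difference of the two piles). -/
def moves : ℕ × ℕ × ℕ → Finset (ℕ × ℕ × ℕ)
  | (a, b, c) =>
    ((Finset.Icc 1 ((b - a) / 2)).image fun k => (a + k, b - k, c)) ∪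
    ((Finset.Icc 1 ((a - b) / 2)).image fun k => (a - k, b + k, c)) ∪
    ((Finset.Icc 1 ((c - a) / 2)).image fun k => (a + k, b, c - k)) ∪
    ((Finset.Icc 1 ((a - c) / 2)).image fun k => (a - k, b, c + k)) ∪
    ((Finset.Icc 1 ((c - b) / 2)).image fun k => (a, b + k, c - k)) ∪
    ((Finset.Icc 1 ((b - c) / 2)).image fun k => (a, b - k, c + k))

/-- The sum of squares of the pile sizes, a measure that strictly decreases along
every move. -/
def measure3 (p : ℕ × ℕ × ℕ) : ℕ := p.1 ^ 2 + p.2.1 ^ 2 + p.2.2 ^ 2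

theorem sq_move_lt {x y k : ℕ} (hk : 1 ≤ k) (h : k ≤ (y - x) / 2) :
    (x + k) ^ 2 + (y - k) ^ 2 < x ^ 2 + y ^ 2 := by
  have h1 : x + 2 * k ≤ y := by omega
  have h2 : k ≤ y := by omega
  zify [h2]
  nlinarith

theorem measure3_lt_of_mem_moves {q p : ℕ × ℕ × ℕ} (h : q ∈ moves p) :
    measure3 q < measure3 p := by
  obtain ⟨a, b, c⟩ := p
  simp only [moves, Finset.mem_union, Finset.mem_image, Finset.mem_Icc] at h
  rcases h with ((((⟨k, ⟨hk1, hk2⟩, rfl⟩ | ⟨k, ⟨hk1, hk2⟩, rfl⟩) | ⟨k, ⟨hk1, hk2⟩, rfl⟩) |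
      ⟨k, ⟨hk1, hk2⟩, rfl⟩) | ⟨k, ⟨hk1, hk2⟩, rfl⟩) | ⟨k, ⟨hk1, hk2⟩, rfl⟩ <;>
    simp only [measure3] <;>
    [linarith [sq_move_lt (x := a) (y := b) hk1 hk2];
     linarith [sq_move_lt (x := b) (y := a) hk1 hk2];
     linarith [sq_move_lt (x := a) (y := c) hk1 hk2];
     linarith [sq_move_lt (x := c) (y := a) hk1 hk2];
     linarith [sq_move_lt (x := b) (y := c) hk1 hk2];
     linarith [sq_move_lt (x := c) (y := b) hk1 hk2]]

/-- The minimum excludant of a finite set of naturals. -/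
noncomputable def mex (s : Finset ℕ) : ℕ := sInf {n : ℕ | n ∉ s}

/-- The Sprague–Grundy value of a position of three-pile Sharing Nim: the minimum
excludant of the Sprague–Grundy values of the positions reachable in one move. -/
noncomputable def G (p : ℕ × ℕ × ℕ) : ℕ :=
  mex ((moves p).attach.image fun q => G q.1)
termination_by measure3 p
decreasing_by exact measure3_lt_of_mem_moves q.2

theorem mex_eq_zero (s : Finset ℕ) : mex s = 0 ↔ 0 ∉ s := by
  have hne : {n : ℕ | n ∉ s}.Nonempty := s.exists_notMem
  unfold mex
  rw [Nat.sInf_eq_zero]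
  constructor
  · rintro (h | h)
    · exact h
    · exact absurd h hne.ne_empty
  · exact fun h => Or.inl h

theorem mex_eq_one (s : Finset ℕ) : mex s = 1 ↔ 0 ∈ s ∧ 1 ∉ s := by
  have hne : {n : ℕ | n ∉ s}.Nonempty := s.exists_notMem
  constructor
  · intro h
    have h0 := mt (mex_eq_zero s).2 (by omega)
    have h1 : mex s ∉ s := Nat.sInf_mem hne
    rw [h] at h1
    exact ⟨by simpa using h0, h1⟩
  · rintro ⟨h0, h1⟩
    have h2 : mex s ≤ 1 := Nat.sInf_le h1
    have h3 : mex s ≠ 0 := fun h => ((mex_eq_zero s).1 h) h0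
    omega

theorem G_eq (p : ℕ × ℕ × ℕ) : G p = mex ((moves p).image G) := by
  rw [G]
  congr 1
  ext n
  simp

theorem G_zero (p : ℕ × ℕ × ℕ) : G p = 0 ↔ ∀ q ∈ moves p, G q ≠ 0 := by
  rw [G_eq, mex_eq_zero]
  simp

theorem G_one (p : ℕ × ℕ × ℕ) :
    G p = 1 ↔ (∃ q ∈ moves p, G q = 0) ∧ ∀ q ∈ moves p, G q ≠ 1 := by
  rw [G_eq, mex_eq_one]
  simp

def sw12 (p : ℕ × ℕ × ℕ) : ℕ × ℕ × ℕ := (p.2.1, p.1, p.2.2)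
def sw23 (p : ℕ × ℕ × ℕ) : ℕ × ℕ × ℕ := (p.1, p.2.2, p.2.1)

theorem moves_sw12 (p : ℕ × ℕ × ℕ) : moves (sw12 p) = (moves p).image sw12 := by
  obtain ⟨a, b, c⟩ := p
  simp only [sw12, moves, Finset.image_union, Finset.image_image, Function.comp_def]
  ext q
  simp only [Finset.mem_union]
  tauto

theorem moves_sw23 (p : ℕ × ℕ × ℕ) : moves (sw23 p) = (moves p).image sw23 := by
  obtain ⟨a, b, c⟩ := p
  simp only [sw23, moves, Finset.image_union, Finset.image_image, Function.comp_def]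
  ext q
  simp only [Finset.mem_union]
  tauto

theorem G_sw12 : ∀ (n : ℕ) (p : ℕ × ℕ × ℕ), measure3 p < n → G (sw12 p) = G p := by
  intro n
  induction n with
  | zero => intro p h; omega
  | succ n ih =>
    intro p h
    rw [G_eq, G_eq p, moves_sw12, Finset.image_image]
    congr 1
    apply Finset.image_congr
    intro q hq
    have := measure3_lt_of_mem_moves (Finset.mem_coe.1 hq)
    exact ih q (by omega)

theorem G_sw23 : ∀ (n : ℕ) (p : ℕ × ℕ × ℕ), measure3 p < n → G (sw23 p) = G p := by
  intro n
  induction n with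
  | zero => intro p h; omega
  | succ n ih =>
    intro p h
    rw [G_eq, G_eq p, moves_sw23, Finset.image_image]
    congr 1
    apply Finset.image_congr
    intro q hq
    have := measure3_lt_of_mem_moves (Finset.mem_coe.1 hq)
    exact ih q (by omega)

theorem G12 (a b c : ℕ) : G (a, b, c) = G (b, a, c) :=
  G_sw12 _ (b, a, c) (Nat.lt_succ_self _)

theorem G23 (a b c : ℕ) : G (a, b, c) = G (a, c, b) :=
  G_sw23 _ (a, c, b) (Nat.lt_succ_self _)

/-- The sorted position with least pile `a` and gaps `x`, `y`. -/
def pos (a x y : ℕ) : ℕ × ℕ × ℕ := (a, a + x, a + x + y)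

theorem mk3 {a b c a' b' c' : ℕ} (h1 : a = a') (h2 : b = b') (h3 : c = c') :
    (a, b, c) = (a', b', c') := by
  rw [h1, h2, h3]

/-- Moves in gap coordinates. -/
def GM (x y x' y' : ℕ) : Prop := ∃ k, 1 ≤ k ∧
  ((2 * k ≤ x ∧ x' + 2 * k = x ∧ y' = y + k) ∨
   (2 * k ≤ y ∧ x' = x + k ∧ y' + 2 * k = y) ∨
   (x' + k = x ∧ y' + k = y) ∨
   (x' + x = k ∧ y' + 2 * k = x + y ∧ x < k) ∨
   (y' + y = k ∧ x' + 2 * k = x + y ∧ y < k))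

theorem GM_symm {x y x' y' : ℕ} (h : GM x y x' y') : GM y x y' x' := by
  obtain ⟨k, hk, h⟩ := h
  exact ⟨k, hk, by omega⟩

theorem moves_to_GM {a x y : ℕ} {q : ℕ × ℕ × ℕ} (h : q ∈ moves (pos a x y)) :
    ∃ a' x' y', G q = G (pos a' x' y') ∧ measure3 (pos a' x' y') = measure3 q ∧
      GM x y x' y' := by
  simp only [pos, moves, Finset.mem_union, Finset.mem_image, Finset.mem_Icc] at h
  rcases h with ((((⟨k, ⟨hk1, hk2⟩, rfl⟩ | ⟨k, ⟨hk1, hk2⟩, rfl⟩) | ⟨k, ⟨hk1, hk2⟩, rfl⟩) |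
      ⟨k, ⟨hk1, hk2⟩, rfl⟩) | ⟨k, ⟨hk1, hk2⟩, rfl⟩) | ⟨k, ⟨hk1, hk2⟩, rfl⟩
  · have e : pos (a + k) (x - 2 * k) (y + k) = (a + k, a + x - k, a + x + y) :=
          mk3 (by omega) (by omega) (by omega)
    exact ⟨a + k, x - 2 * k, y + k, by rw [e], by rw [e], k, hk1, by omega⟩
  · omega
  · by_cases h1 : x < k
    · have e : pos (a + x) (k - x) (x + y - 2 * k) = (a + x, a + k, a + x + y - k) :=
          mk3 (by omega) (by omega) (by omega)
      refine ⟨a + x, k - x, x + y - 2 * k, ?_, ?_, k, hk1, by omega⟩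
      · rw [e, G12]
      · rw [e]; simp only [measure3]; ring
    · by_cases h2 : y < k
      · have e : pos (a + k) (x + y - 2 * k) (k - y) = (a + k, a + x + y - k, a + x) :=
          mk3 (by omega) (by omega) (by omega)
        refine ⟨a + k, x + y - 2 * k, k - y, ?_, ?_, k, hk1, by omega⟩
        · rw [e, G23]
        · rw [e]; simp only [measure3]; ring
      · have e : pos (a + k) (x - k) (y - k) = (a + k, a + x, a + x + y - k) :=
          mk3 (by omega) (by omega) (by omega)
        exact ⟨a + k, x - k, y - k, by rw [e], by rw [e], k, hk1, by omega⟩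
  · omega
  · have e : pos a (x + k) (y - 2 * k) = (a, a + x + k, a + x + y - k) :=
          mk3 (by omega) (by omega) (by omega)
    exact ⟨a, x + k, y - 2 * k, by rw [e], by rw [e], k, hk1, by omega⟩
  · omega

theorem GM_to_moves (a : ℕ) {x y x' y' : ℕ} (h : GM x y x' y') :
    ∃ q ∈ moves (pos a x y), ∃ a', G q = G (pos a' x' y') ∧
      measure3 (pos a' x' y') = measure3 q := by
  obtain ⟨k, hk1, h⟩ := h
  simp only [pos, moves, Finset.mem_union, Finset.mem_image, Finset.mem_Icc]
  rcases h with h | h | h | h | h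
  · have e : pos (a + k) x' y' = (a + k, a + x - k, a + x + y) :=
          mk3 (by omega) (by omega) (by omega)
    refine ⟨_, Or.inl (Or.inl (Or.inl (Or.inl (Or.inl ⟨k, by omega, rfl⟩)))), a + k, ?_, ?_⟩
    · rw [← e]; rfl
    · rw [← e]; rfl
  · have e : pos a x' y' = (a, a + x + k, a + x + y - k) :=
          mk3 (by omega) (by omega) (by omega)
    refine ⟨_, Or.inl (Or.inr ⟨k, by omega, rfl⟩), a, ?_, ?_⟩
    · rw [← e]; rfl
    · rw [← e]; rfl
  · have e : pos (a + k) x' y' = (a + k, a + x, a + x + y - k) :=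
          mk3 (by omega) (by omega) (by omega)
    refine ⟨_, Or.inl (Or.inl (Or.inl (Or.inr ⟨k, by omega, rfl⟩))), a + k, ?_, ?_⟩
    · rw [← e]; rfl
    · rw [← e]; rfl
  · have e : pos (a + x) x' y' = (a + x, a + k, a + x + y - k) :=
          mk3 (by omega) (by omega) (by omega)
    refine ⟨_, Or.inl (Or.inl (Or.inl (Or.inr ⟨k, by omega, rfl⟩))), a + x, ?_, ?_⟩
    · rw [G12, ← e]; rfl
    · change measure3 (pos _ _ _) = _
      rw [e]; simp only [measure3]; ring
  · have e : pos (a + k) x' y' = (a + k, a + x + y - k, a + x) :=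
          mk3 (by omega) (by omega) (by omega)
    refine ⟨_, Or.inl (Or.inl (Or.inl (Or.inr ⟨k, by omega, rfl⟩))), a + k, ?_, ?_⟩
    · rw [G23, ← e]; rfl
    · change measure3 (pos _ _ _) = _
      rw [e]; simp only [measure3]; ring

/-- `n` is zero or has even 2-adic valuation. -/
def E (n : ℕ) : Prop := n = 0 ∨ Even (padicValNat 2 n)

theorem E_odd {n : ℕ} (h : n % 2 = 1) : E n := by
  right
  rw [padicValNat.eq_zero_of_not_dvd (by omega)]
  exact Even.zero

theorem E_double {m : ℕ} (h : 0 < m) : E (2 * m) ↔ ¬ E m := by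
  have : Fact (Nat.Prime 2) := ⟨Nat.prime_two⟩
  unfold E
  rw [padicValNat.mul (by omega) (by omega), padicValNat_self, add_comm, Nat.even_add_one]
  have h1 : m ≠ 0 := by omega
  have h2 : 2 * m ≠ 0 := by omega
  tauto

def Z (x y : ℕ) : Prop := (x = 0 ∨ y = 0) ∧ E (x + y)

def O (x y : ℕ) : Prop :=
  (x = 0 ∧ y % 4 = 2) ∨ (y = 0 ∧ x % 4 = 2) ∨ (x = 2 ∧ y % 4 = 3) ∨ (y = 2 ∧ x % 4 = 3) ∨
    (x = 1 ∧ y = 1)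

theorem Z_symm {x y : ℕ} (h : Z x y) : Z y x := by
  unfold Z at *
  rw [add_comm]; tauto

theorem O_symm {x y : ℕ} (h : O x y) : O y x := by
  unfold O at *; omega

theorem Z_not {x y x' y' : ℕ} (h : Z x y) (hm : GM x y x' y') : ¬ Z x' y' := by
  obtain ⟨k, hk, hm⟩ := hm
  rintro ⟨h1, h2⟩
  obtain ⟨h3, h4⟩ := h
  have e : x + y = 2 * k ∧ x' + y' = k := by omega
  rw [e.1, E_double hk] at h4
  rw [e.2] at h2
  exact h4 h2

theorem not_Z_aux {x y : ℕ} (hxy : x ≤ y) (h : ¬ Z x y) : ∃ x' y', GM x y x' y' ∧ Z x' y' := by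
  obtain ⟨d, rfl⟩ := Nat.exists_eq_add_of_le hxy
  by_cases hd : E d
  · have hx : 1 ≤ x := by
      by_contra h0
      have h0 : x = 0 := by omega
      subst h0
      exact h ⟨Or.inl rfl, by simpa using hd⟩
    exact ⟨0, d, ⟨x, hx, by omega⟩, Or.inl rfl, by simpa using hd⟩
  · have h2 : d % 2 = 0 := by
      by_contra h2
      exact hd (E_odd (by omega))
    obtain ⟨m, rfl⟩ : ∃ m, d = 2 * m := ⟨d / 2, by omega⟩
    have hm : 0 < m := by
      by_contra h0
      exact hd (Or.inl (by omega))
    rw [E_double hm, not_not] at hd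
    exact ⟨m, 0, ⟨x + m, by omega, by omega⟩, Or.inr rfl, by simpa using hd⟩

theorem not_Z {x y : ℕ} (h : ¬ Z x y) : ∃ x' y', GM x y x' y' ∧ Z x' y' := by
  rcases le_total x y with hxy | hxy
  · exact not_Z_aux hxy h
  · obtain ⟨x', y', h1, h2⟩ := not_Z_aux hxy (fun h' => h (Z_symm h'))
    exact ⟨y', x', GM_symm h1, Z_symm h2⟩

theorem O_not_Z {x y : ℕ} (h : O x y) : ¬ Z x y := by
  rintro ⟨h1, h2⟩
  unfold O at h
  have e : (x + y) % 4 = 2 := by omega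
  obtain ⟨m, hm⟩ : ∃ m, x + y = 2 * m := ⟨(x + y) / 2, by omega⟩
  rw [hm, E_double (by omega)] at h2
  exact h2 (E_odd (by omega))

theorem O_not {x y x' y' : ℕ} (h : O x y) (hm : GM x y x' y') : ¬ O x' y' := by
  obtain ⟨k, hk, hm⟩ := hm
  unfold O at *
  rcases h with h | h | h | h | h <;> rcases hm with hm | hm | hm | hm | hm <;> omega

set_option maxHeartbeats 2000000 in
theorem not_O_aux {x y : ℕ} (hxy : x ≤ y) (hZ : ¬ Z x y) (hO : ¬ O x y) :
    ∃ x' y', GM x y x' y' ∧ O x' y' := by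
  obtain ⟨d, rfl⟩ := Nat.exists_eq_add_of_le hxy
  by_cases hx : x = 0
  · subst hx
    have hE : ¬ E d := fun h => hZ ⟨Or.inl rfl, by simpa using h⟩
    have hd0 : d ≠ 0 := fun h => hE (Or.inl h)
    have h2 : d % 2 = 0 := by
      by_contra h2
      exact hE (E_odd (by omega))
    have h4 : d % 4 = 0 := by unfold O at hO; omega
    obtain ⟨m, rfl⟩ : ∃ m, d = 2 * (2 * m) := ⟨d / 4, by omega⟩
    rw [E_double (by omega), E_double (by omega), not_not] at hE
    have h3 : m % 2 = 0 := by
      by_contra h2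
      exact hE (E_odd (by omega))
    exact ⟨2 * m - 1, 2, ⟨2 * m - 1, by omega, by omega⟩, by unfold O; omega⟩
  · by_cases c2 : d % 4 = 2
    · exact ⟨0, d, ⟨x, by omega, by omega⟩, by unfold O; omega⟩
    by_cases c4 : d % 8 = 4
    · exact ⟨d / 2, 0, ⟨x + d / 2, by omega, by omega⟩, by unfold O; omega⟩
    by_cases c0 : d = 0
    · have : x ≠ 1 := by unfold O at hO; omega
      exact ⟨1, 1, ⟨x - 1, by omega, by omega⟩, by unfold O; omega⟩
    by_cases c8 : d % 8 = 0
    · exact ⟨d / 2 - 1, 2, ⟨x + (d / 2 - 1), by omega, by omega⟩, by unfold O; omega⟩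
    by_cases c3 : d % 4 = 3
    · by_cases c : d = 3
      · exact ⟨1, 1, ⟨x + 1, by omega, by omega⟩, by unfold O; omega⟩
      · exact ⟨2, d - 4, ⟨x + 2, by omega, by omega⟩, by unfold O; omega⟩
    have hx2 : x ≠ 2 := by unfold O at hO; omega
    by_cases c1 : x = 1
    · subst c1
      by_cases c : d % 8 = 1
      · exact ⟨1 + (1 + d) / 2, 0, ⟨(1 + d) / 2, by omega, by omega⟩, by unfold O; omega⟩
      · exact ⟨1 + (d - 1) / 2, 2, ⟨(d - 1) / 2, by omega, by omega⟩, by unfold O; omega⟩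
    · exact ⟨2, 2 + d, ⟨x - 2, by omega, by omega⟩, by unfold O; omega⟩

theorem not_O {x y : ℕ} (hZ : ¬ Z x y) (hO : ¬ O x y) : ∃ x' y', GM x y x' y' ∧ O x' y' := by
  rcases le_total x y with hxy | hxy
  · exact not_O_aux hxy hZ hO
  · obtain ⟨x', y', h1, h2⟩ :=
      not_O_aux hxy (fun h' => hZ (Z_symm h')) (fun h' => hO (O_symm h'))
    exact ⟨y', x', GM_symm h1, O_symm h2⟩

/-- Full characterization of the positions of values 0 and 1. -/
theorem main_char : ∀ (n a x y : ℕ), measure3 (pos a x y) < n →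
    ((G (pos a x y) = 0 ↔ Z x y) ∧ (G (pos a x y) = 1 ↔ O x y)) := by
  intro n
  induction n with
  | zero => intro a x y h; omega
  | succ n ih =>
    intro a x y h
    have up : ∀ q ∈ moves (pos a x y), ∃ x' y', GM x y x' y' ∧ (G q = 0 ↔ Z x' y') ∧
        (G q = 1 ↔ O x' y') := by
      intro q hq
      obtain ⟨a', x', y', h1, h2, h3⟩ := moves_to_GM hq
      have := measure3_lt_of_mem_moves hq
      rw [h1]
      exact ⟨x', y', h3, ih a' x' y' (by omega)⟩
    have dn : ∀ x' y', GM x y x' y' → ∃ q ∈ moves (pos a x y), (G q = 0 ↔ Z x' y') ∧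
        (G q = 1 ↔ O x' y') := by
      intro x' y' hm
      obtain ⟨q, hq, a', h1, h2⟩ := GM_to_moves a hm
      have := measure3_lt_of_mem_moves hq
      refine ⟨q, hq, ?_⟩
      rw [h1]
      exact ih a' x' y' (by omega)
    constructor
    · rw [G_zero]
      constructor
      · intro hall
        by_contra hZ
        obtain ⟨x', y', hm, hz⟩ := not_Z hZ
        obtain ⟨q, hq, h1, -⟩ := dn x' y' hm
        exact hall q hq (h1.2 hz)
      · intro hZ q hq h0
        obtain ⟨x', y', hm, h1, -⟩ := up q hq
        exact Z_not hZ hm (h1.1 h0)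
    · rw [G_one]
      constructor
      · rintro ⟨⟨q, hq, h0⟩, hall⟩
        obtain ⟨x', y', hm, h1, -⟩ := up q hq
        have hZ : ¬ Z x y := fun hZ => Z_not hZ hm (h1.1 h0)
        by_contra hO
        obtain ⟨x', y', hm, ho⟩ := not_O hZ hO
        obtain ⟨q, hq, -, h1⟩ := dn x' y' hm
        exact hall q hq (h1.2 ho)
      · intro hO
        constructor
        · obtain ⟨x', y', hm, hz⟩ := not_Z (O_not_Z hO)
          obtain ⟨q, hq, h1, -⟩ := dn x' y' hm
          exact ⟨q, hq, h1.2 hz⟩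
        · intro q hq h0
          obtain ⟨x', y', hm, -, h1⟩ := up q hq
          exact O_not hO hm (h1.1 h0)

/-- Among positions `(0,a,b)` with `2a ≤ b`, the positions of
Sprague–Grundy value 1 have `a = 0` or `a = 2`, except for `(0,1,2)`. -/
theorem grundy_one_rows (a b : ℕ) (hab : 2 * a ≤ b) (h : G (0, a, b) = 1) :
    a = 0 ∨ a = 2 ∨ (a = 1 ∧ b = 2) := by
  have e : pos 0 a (b - a) = (0, a, b) :=
          mk3 (by omega) (by omega) (by omega)
  rw [← e] at h
  have hO := (main_char _ 0 a (b - a) (Nat.lt_succ_self _)).2.1 h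
  unfold O at hO
  omega

end SharingNim
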